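/- arXiv:0909.4134 — 2 statements merged into one kernel-verified Lean document; each statement's English description precedes it below -/
import Mathlib

section
/- Let σ ⊆ ℝ^n be a closed convex cone containing 0, let K ⊆ ℝ^n be a nonempty compact convex set, and let Δ = K + σ. Then Δ is recovered from its support function on the dual cone: Δ = {p ∈ ℝ^n : ⟨m,p⟩ ≥ h_Δ(m) for all m ∈ σ^∨}. -/
open Pointwise RealInnerProductSpace

/-- Let `σ ⊆ ℝ^n` be a closed convex cone containing `0`, let
`K` be a nonempty compact convex set and `Δ = K + σ`. Then `Δ` is recovered
from its support function on the dual cone: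
`Δ = {p : ⟨m,p⟩ ≥ h_Δ(m) for all m ∈ σ^∨}`. -/
theorem polyhedron_recovered_from_support_function
    (n : ℕ) (σ K Δ : Set (EuclideanSpace ℝ (Fin n)))
    (hσconv : Convex ℝ σ) (hσ0 : (0 : EuclideanSpace ℝ (Fin n)) ∈ σ)
    (hσcone : ∀ c : ℝ, 0 ≤ c → ∀ x ∈ σ, c • x ∈ σ)
    (hσclosed : IsClosed σ)
    (hKne : K.Nonempty) (hKcomp : IsCompact K) (hKconv : Convex ℝ K)
    (hΔ : Δ = K + σ) :
    Δ = {p : EuclideanSpace ℝ (Fin n) |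
          ∀ m : EuclideanSpace ℝ (Fin n), (∀ x ∈ σ, 0 ≤ ⟪m, x⟫) →
            sInf {z : ℝ | ∃ q ∈ Δ, z = ⟪m, q⟫} ≤ ⟪m, p⟫} := by
  subst hΔ
  have hsub : K ⊆ K + σ := fun k hk => ⟨k, hk, 0, hσ0, add_zero k⟩
  refine Set.Subset.antisymm (fun p hp m hm => csInf_le ?_ ⟨p, hp, rfl⟩) fun p hp => ?_
  · obtain ⟨b, hb⟩ := hKcomp.bddBelow_image (f := fun k => ⟪m, k⟫) (by fun_prop)
    refine ⟨b, ?_⟩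
    rintro _ ⟨_, ⟨k, hk, x, hx, rfl⟩, rfl⟩
    have hk' : b ≤ ⟪m, k⟫ := hb ⟨k, hk, rfl⟩
    have hx' := hm x hx
    simp only [inner_add_right]
    linarith
  · by_contra hpΔ
    obtain ⟨f, u, hfp, hfΔ⟩ := geometric_hahn_banach_point_closed
      (hKconv.add hσconv) (hσclosed.add_left_of_isCompact hKcomp) hpΔ
    obtain ⟨k, hk⟩ := hKne
    have hfk := hfΔ k (hsub hk)
    have hfσ : ∀ x ∈ σ, 0 ≤ f x := by
      intro x hx
      by_contra! hneg
      have hc : 0 ≤ (f k - u) / (-f x) := div_nonneg (by linarith) (by linarith)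
      have hlt := hfΔ _ ⟨k, hk, _, hσcone _ hc x hx, rfl⟩
      have hcancel : (f k - u) / (-f x) * f x = u - f k := by
        have := hneg.ne
        field_simp
        ring
      simp only [map_add, map_smul, smul_eq_mul] at hlt
      linarith
    have hinf := hp ((InnerProductSpace.toDual ℝ _).symm f)
      (by simpa only [InnerProductSpace.toDual_symm_apply] using hfσ)
    simp only [InnerProductSpace.toDual_symm_apply] at hinf
    have hu : u ≤ sInf {z : ℝ | ∃ q ∈ K + σ, z = f q} := by
      refine le_csInf ⟨_, k, hsub hk, rfl⟩ ?_
      rintro _ ⟨q, hq, rfl⟩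
      exact (hfΔ q hq).le
    linarith
end

section
/- Let σ ⊆ ℝ^n be a convex cone containing 0 which is pointed, i.e. σ ∩ (−σ) = {0}, and let Δ₁, …, Δ_k ⊆ ℝ^n with Δ_i = K_i + σ, where each K_i is nonempty and compact. Let σ̂ ⊆ ℝ^n × ℝ^k be the smallest convex cone containing (σ × {0}) ∪ ⋃_{i=1}^k (Δ_i × {e_i}), where e₁, …, e_k is the standard basis of ℝ^k. Then σ̂ is pointed: σ̂ ∩ (−σ̂) = {0}. -/
open Pointwise

/-- The smallest convex cone containing a set `S`: all finite nonnegative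
linear combinations of elements of `S`. -/
def coneHull {E : Type*} [AddCommMonoid E] [Module ℝ E] (S : Set E) : Set E :=
  {y | ∃ (N : ℕ) (c : Fin N → ℝ) (v : Fin N → E),
    (∀ j, 0 ≤ c j) ∧ (∀ j, v j ∈ S) ∧ y = ∑ j, c j • v j}

theorem nonneg_of_mem_coneHull {E : Type*} [AddCommMonoid E] [Module ℝ E] {S : Set E}
    (f : E →ₗ[ℝ] ℝ) (hf : ∀ v ∈ S, 0 ≤ f v) {y : E} (hy : y ∈ coneHull S) : 0 ≤ f y := by
  obtain ⟨N, c, v, hc, hv, rfl⟩ := hy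
  simp only [map_sum, map_smul, smul_eq_mul]
  exact Finset.sum_nonneg fun j _ => mul_nonneg (hc j) (hf _ (hv j))

/-- If `f` is nonnegative on `S` and the zeros of `f` in `S` lie in the cone `T`, then so do the
zeros of `f` in the cone generated by `S`. -/
theorem mem_of_mem_coneHull_of_map_eq_zero {E : Type*} [AddCommMonoid E] [Module ℝ E] {S : Set E}
    (T : PointedCone ℝ E) (f : E →ₗ[ℝ] ℝ) (hf : ∀ v ∈ S, 0 ≤ f v)
    (hT : ∀ v ∈ S, f v = 0 → v ∈ T) {y : E} (hy : y ∈ coneHull S) (hy0 : f y = 0) : y ∈ T := by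
  obtain ⟨N, c, v, hc, hv, rfl⟩ := hy
  simp only [map_sum, map_smul, smul_eq_mul] at hy0
  rw [Finset.sum_eq_zero_iff_of_nonneg fun j _ => mul_nonneg (hc j) (hf _ (hv j))] at hy0
  refine sum_mem fun j hj => ?_
  rcases mul_eq_zero.mp (hy0 j hj) with h | h
  · simp [h]
  · exact T.smul_mem (hc j) (hT _ (hv j) h)

theorem zero_mem_coneHull {E : Type*} [AddCommMonoid E] [Module ℝ E] (S : Set E) :
    (0 : E) ∈ coneHull S :=
  ⟨0, Fin.elim0, Fin.elim0, fun j => j.elim0, fun j => j.elim0, by simp⟩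

/-- Let `σ ⊆ ℝ^n` be a pointed convex cone containing `0`
(`σ ∩ (-σ) = {0}`), and let `Δᵢ = Kᵢ + σ` with `Kᵢ` nonempty compact. Let
`σ̂ ⊆ ℝ^n × ℝ^k` be the smallest convex cone containing
`(σ × {0}) ∪ ⋃ᵢ (Δᵢ × {eᵢ})`, where `eᵢ` is the standard basis of `ℝ^k`.
Then `σ̂` is pointed: `σ̂ ∩ (-σ̂) = {0}`. -/
theorem generated_cone_is_pointed
    (n k : ℕ) (σ : Set (EuclideanSpace ℝ (Fin n)))
    (K Δ : Fin k → Set (EuclideanSpace ℝ (Fin n)))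
    (hσconv : Convex ℝ σ) (hσ0 : (0 : EuclideanSpace ℝ (Fin n)) ∈ σ)
    (hσcone : ∀ c : ℝ, 0 ≤ c → ∀ x ∈ σ, c • x ∈ σ)
    (hσpointed : σ ∩ (-σ) = {0})
    (hKne : ∀ i, (K i).Nonempty) (hKcomp : ∀ i, IsCompact (K i))
    (hΔ : ∀ i, Δ i = K i + σ)
    (σhat : Set (EuclideanSpace ℝ (Fin n) × EuclideanSpace ℝ (Fin k)))
    (hσhat : σhat = coneHull (σ ×ˢ ({0} : Set (EuclideanSpace ℝ (Fin k))) ∪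
        ⋃ i : Fin k, (Δ i) ×ˢ ({EuclideanSpace.single i (1 : ℝ)} :
          Set (EuclideanSpace ℝ (Fin k))))) :
    σhat ∩ (-σhat) = {0} := by
  subst hσhat
  let C : PointedCone ℝ (EuclideanSpace ℝ (Fin n)) :=
    { carrier := σ
      zero_mem' := hσ0
      smul_mem' := fun c x hx => hσcone c c.2 x hx
      add_mem' := fun {x y} hx hy => by
        have h := hσcone 2 zero_le_two _ (hσconv hx hy (by norm_num : (0 : ℝ) ≤ 1 / 2)
          (by norm_num : (0 : ℝ) ≤ 1 / 2) (by norm_num))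
        simpa [smul_add, smul_smul] using h }
  let T : PointedCone ℝ (EuclideanSpace ℝ (Fin n) × EuclideanSpace ℝ (Fin k)) :=
    Submodule.prod C ⊥
  let f : EuclideanSpace ℝ (Fin n) × EuclideanSpace ℝ (Fin k) →ₗ[ℝ] ℝ :=
    { toFun := fun y => ∑ i, y.2 i
      map_add' := fun x y => by simp [Finset.sum_add_distrib]
      map_smul' := fun c x => by simp [Finset.mul_sum] }
  set S := σ ×ˢ ({0} : Set (EuclideanSpace ℝ (Fin k))) ∪
        ⋃ i : Fin k, (Δ i) ×ˢ ({EuclideanSpace.single i (1 : ℝ)} :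
          Set (EuclideanSpace ℝ (Fin k))) with hS
  have hcases : ∀ v ∈ S, v ∈ T ∧ f v = 0 ∨ f v = 1 := by
    rintro ⟨x, z⟩ (⟨hx, hz⟩ | hv)
    · obtain rfl : z = 0 := hz
      exact Or.inl ⟨⟨hx, rfl⟩, by simp [f]⟩
    · obtain ⟨i, -, hz⟩ := Set.mem_iUnion.mp hv
      obtain rfl : z = EuclideanSpace.single i 1 := hz
      exact Or.inr (by simp [f])
  have hf : ∀ v ∈ S, 0 ≤ f v := fun v hv => by
    rcases hcases v hv with h | h
    · exact h.2.ge
    · simp [h]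
  have hT : ∀ v ∈ S, f v = 0 → v ∈ T := fun v hv h0 => by
    rcases hcases v hv with h | h
    · exact h.1
    · simp [h] at h0
  refine Set.Subset.antisymm ?_ ?_
  · rintro y ⟨hy, hny⟩
    have hny : -y ∈ coneHull S := hny
    have hpos := nonneg_of_mem_coneHull f hf hy
    have hneg := nonneg_of_mem_coneHull f hf hny
    rw [map_neg] at hneg
    have h0 : f y = 0 := by linarith
    have hyT := mem_of_mem_coneHull_of_map_eq_zero T f hf hT hy h0
    have hnyT := mem_of_mem_coneHull_of_map_eq_zero T f hf hT hny (by simp [h0])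
    have h1 : y.1 ∈ σ ∩ (-σ) := ⟨hyT.1, hnyT.1⟩
    rw [hσpointed] at h1
    exact Prod.ext h1 hyT.2
  · rintro _ rfl
    exact ⟨zero_mem_coneHull S, by simpa using zero_mem_coneHull S⟩
end
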